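/- Fix μ, δ ∈ ℝ, θ ∈ [0, 2π), and weights κ₁, κ₂, κ₃ ≥ 0 with κ₁ + κ₂ + κ₃ = 1. Let K₁ = [[sinh(μ)·η₂, cosh(μ)·I₂],[cosh(μ)·I₂, sinh(μ)·η₂]] (phase conjugation), K₂ = [[cos(θ)·I₂, −sin(θ)·I₂],[sin(θ)·I₂, cos(θ)·I₂]] (beamsplitter), K₃ = [[cosh(δ)·I₂, sinh(δ)·η₂],[sinh(δ)·η₂, cosh(δ)·I₂]] (amplifier), and let D(V) = Σ_{j=1}^{3} κ_j (K_j V K_jᵀ − V) be the unitary dissipator. Let V(ν₁,ν₂,r) be the 4×4 squeezed-thermal covariance matrix in standard form with ν₁, ν₂ ≥ 1/2 and r > 0. If there exists a real symmetric 4×4 matrix G with JGV − VGJ + D(V) = 0, then κ₁(cosh(2μ) − 1) + κ₂ sin²(θ)(cosh(4r) − 1) + κ₃(cosh(2δ) − 1) = 0; i.e., only trivial channel parameters admit stabilizable squeezed thermal states. -/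

import Mathlib

open Matrix

noncomputable def J4 : Matrix (Fin 4) (Fin 4) ℝ :=
  !![0, 1, 0, 0; -1, 0, 0, 0; 0, 0, 0, 1; 0, 0, -1, 0]

noncomputable def Vsf (ν₁ ν₂ r : ℝ) : Matrix (Fin 4) (Fin 4) ℝ :=
  !![ν₁ * Real.cosh r ^ 2 + ν₂ * Real.sinh r ^ 2, 0,
       (ν₁ + ν₂) / 2 * Real.sinh (2*r), 0;
     0, ν₁ * Real.cosh r ^ 2 + ν₂ * Real.sinh r ^ 2, 0,
       -((ν₁ + ν₂) / 2 * Real.sinh (2*r));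
     (ν₁ + ν₂) / 2 * Real.sinh (2*r), 0,
       ν₁ * Real.sinh r ^ 2 + ν₂ * Real.cosh r ^ 2, 0;
     0, -((ν₁ + ν₂) / 2 * Real.sinh (2*r)), 0,
       ν₁ * Real.sinh r ^ 2 + ν₂ * Real.cosh r ^ 2]

noncomputable def Kpc (μ : ℝ) : Matrix (Fin 4) (Fin 4) ℝ :=
  !![Real.sinh μ, 0, Real.cosh μ, 0;
     0, -Real.sinh μ, 0, Real.cosh μ;
     Real.cosh μ, 0, Real.sinh μ, 0;
     0, Real.cosh μ, 0, -Real.sinh μ]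

noncomputable def Kbs (θ : ℝ) : Matrix (Fin 4) (Fin 4) ℝ :=
  !![Real.cos θ, 0, -Real.sin θ, 0;
     0, Real.cos θ, 0, -Real.sin θ;
     Real.sin θ, 0, Real.cos θ, 0;
     0, Real.sin θ, 0, Real.cos θ]

noncomputable def Kamp (δ : ℝ) : Matrix (Fin 4) (Fin 4) ℝ :=
  !![Real.cosh δ, 0, Real.sinh δ, 0;
     0, Real.cosh δ, 0, -Real.sinh δ;
     Real.sinh δ, 0, Real.cosh δ, 0;
     0, -Real.sinh δ, 0, Real.cosh δ]

/-- Two-mode squeezing parametrization of `Vsf` in terms of `cosh (2 * r)` and `sinh (2 * r)`. -/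
theorem Vsf_eq (ν₁ ν₂ r : ℝ) :
    Vsf ν₁ ν₂ r =
      !![(ν₁ + ν₂) / 2 * Real.cosh (2*r) + (ν₁ - ν₂) / 2, 0,
           (ν₁ + ν₂) / 2 * Real.sinh (2*r), 0;
         0, (ν₁ + ν₂) / 2 * Real.cosh (2*r) + (ν₁ - ν₂) / 2, 0,
           -((ν₁ + ν₂) / 2 * Real.sinh (2*r));
         (ν₁ + ν₂) / 2 * Real.sinh (2*r), 0,
           (ν₁ + ν₂) / 2 * Real.cosh (2*r) - (ν₁ - ν₂) / 2, 0;
         0, -((ν₁ + ν₂) / 2 * Real.sinh (2*r)), 0,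
           (ν₁ + ν₂) / 2 * Real.cosh (2*r) - (ν₁ - ν₂) / 2] := by
  have h₁ : ν₁ * Real.cosh r ^ 2 + ν₂ * Real.sinh r ^ 2 =
      (ν₁ + ν₂) / 2 * Real.cosh (2*r) + (ν₁ - ν₂) / 2 := by
    rw [Real.cosh_two_mul, Real.cosh_sq]; ring
  have h₂ : ν₁ * Real.sinh r ^ 2 + ν₂ * Real.cosh r ^ 2 =
      (ν₁ + ν₂) / 2 * Real.cosh (2*r) - (ν₁ - ν₂) / 2 := by
    rw [Real.cosh_two_mul, Real.cosh_sq]; ring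
  rw [Vsf, h₁, h₂]

/-- `S⁻ᵀ S⁻¹` for the two-mode squeezer `S` that diagonalizes `Vsf ν₁ ν₂ r`. -/
noncomputable def squeezeDual (r : ℝ) : Matrix (Fin 4) (Fin 4) ℝ :=
  !![Real.cosh (2*r), 0, -Real.sinh (2*r), 0;
     0, Real.cosh (2*r), 0, Real.sinh (2*r);
     -Real.sinh (2*r), 0, Real.cosh (2*r), 0;
     0, Real.sinh (2*r), 0, Real.cosh (2*r)]

theorem trace_squeezeDual_mul_hamiltonian (ν₁ ν₂ r : ℝ) (G : Matrix (Fin 4) (Fin 4) ℝ)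
    (hG : Gᵀ = G) :
    (squeezeDual r * (J4 * G * Vsf ν₁ ν₂ r - Vsf ν₁ ν₂ r * G * J4)).trace = 0 := by
  have hs : ∀ i j : Fin 4, G j i = G i j := fun i j => congrFun (congrFun hG i) j
  simp only [Vsf_eq, squeezeDual, J4, Matrix.trace, Matrix.diag, Matrix.mul_apply,
    Matrix.sub_apply, Fin.sum_univ_four]
  simp
  rw [hs 0 1, hs 0 3, hs 1 2, hs 2 3]
  ring

theorem trace_squeezeDual_mul_Kpc (μ ν₁ ν₂ r : ℝ) :
    (squeezeDual r * (Kpc μ * Vsf ν₁ ν₂ r * (Kpc μ)ᵀ - Vsf ν₁ ν₂ r)).trace =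
      2 * (ν₁ + ν₂) * (Real.cosh (2*μ) - 1) := by
  have hr := Real.cosh_sq (2*r)
  have hμ := Real.cosh_sq μ
  rw [Real.cosh_two_mul μ]
  simp only [Vsf_eq, squeezeDual, Kpc, Matrix.trace, Matrix.diag, Matrix.mul_apply,
    Matrix.sub_apply, Matrix.transpose_apply, Fin.sum_univ_four]
  simp
  grind

theorem trace_squeezeDual_mul_Kbs (θ ν₁ ν₂ r : ℝ) :
    (squeezeDual r * (Kbs θ * Vsf ν₁ ν₂ r * (Kbs θ)ᵀ - Vsf ν₁ ν₂ r)).trace =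
      2 * (ν₁ + ν₂) * (Real.sin θ ^ 2 * (Real.cosh (4*r) - 1)) := by
  have hr := Real.cosh_sq (2*r)
  have hθ := Real.sin_sq_add_cos_sq θ
  rw [show 4 * r = 2 * (2 * r) by ring, Real.cosh_two_mul (2*r)]
  simp only [Vsf_eq, squeezeDual, Kbs, Matrix.trace, Matrix.diag, Matrix.mul_apply,
    Matrix.sub_apply, Matrix.transpose_apply, Fin.sum_univ_four]
  simp
  grind

theorem trace_squeezeDual_mul_Kamp (δ ν₁ ν₂ r : ℝ) :
    (squeezeDual r * (Kamp δ * Vsf ν₁ ν₂ r * (Kamp δ)ᵀ - Vsf ν₁ ν₂ r)).trace =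
      2 * (ν₁ + ν₂) * (Real.cosh (2*δ) - 1) := by
  have hr := Real.cosh_sq (2*r)
  have hδ := Real.cosh_sq δ
  rw [Real.cosh_two_mul δ]
  simp only [Vsf_eq, squeezeDual, Kamp, Matrix.trace, Matrix.diag, Matrix.mul_apply,
    Matrix.sub_apply, Matrix.transpose_apply, Fin.sum_univ_four]
  simp
  grind

theorem stmt_18 (μ δ θ : ℝ) (hθ0 : 0 ≤ θ) (hθ1 : θ < 2 * Real.pi)
    (κ₁ κ₂ κ₃ : ℝ) (hκ₁ : 0 ≤ κ₁) (hκ₂ : 0 ≤ κ₂) (hκ₃ : 0 ≤ κ₃)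
    (hκsum : κ₁ + κ₂ + κ₃ = 1)
    (ν₁ ν₂ r : ℝ) (h1 : 1/2 ≤ ν₁) (h2 : 1/2 ≤ ν₂) (hr : 0 < r)
    (G : Matrix (Fin 4) (Fin 4) ℝ) (hGsymm : Gᵀ = G)
    (hstab : J4 * G * Vsf ν₁ ν₂ r - Vsf ν₁ ν₂ r * G * J4
      + (κ₁ • (Kpc μ * Vsf ν₁ ν₂ r * (Kpc μ)ᵀ - Vsf ν₁ ν₂ r)
        + κ₂ • (Kbs θ * Vsf ν₁ ν₂ r * (Kbs θ)ᵀ - Vsf ν₁ ν₂ r)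
        + κ₃ • (Kamp δ * Vsf ν₁ ν₂ r * (Kamp δ)ᵀ - Vsf ν₁ ν₂ r)) = 0) :
    κ₁ * (Real.cosh (2*μ) - 1) + κ₂ * Real.sin θ ^ 2 * (Real.cosh (4*r) - 1)
      + κ₃ * (Real.cosh (2*δ) - 1) = 0 := by
  have h := congrArg (fun M => (squeezeDual r * M).trace) hstab
  simp only [Matrix.mul_add, Matrix.trace_add, Matrix.mul_smul, Matrix.trace_smul, smul_eq_mul,
    trace_squeezeDual_mul_hamiltonian ν₁ ν₂ r G hGsymm, trace_squeezeDual_mul_Kpc,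
    trace_squeezeDual_mul_Kbs, trace_squeezeDual_mul_Kamp, Matrix.mul_zero,
    Matrix.trace_zero] at h
  have hν : 2 * (ν₁ + ν₂) ≠ 0 := by linarith
  refine (mul_eq_zero.mp ?_).resolve_left hν
  linear_combination h
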